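/- arXiv:math/0411440 — 2 statements merged into one kernel-verified Lean document; each statement's English description precedes it below -/
import Mathlib

section
/- Let A be a unital associative ℚ(q)-algebra and let x, w ∈ A satisfy xw = q²wx. Then for all n ∈ ℕ and t ∈ ℤ: C_q(x + (q − q^{−1})² w; t, n) = Σ_{r=0}^{n} q^{r(t−n)} (q − q^{−1})^r · w^{(r)} · {x; t | n, r}. -/
open Finset

noncomputable section

/-- The base field `ℚ(q)` of rational functions over `ℚ`. -/
abbrev K : Type := RatFunc ℚ

/-- The indeterminate `q`. -/
def q : K := RatFunc.X

/-- The `x`-number `(n)_x = (x^n - 1)/(x - 1)`. -/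
def qn (x : K) (n : ℕ) : K := (x ^ n - 1) / (x - 1)

/-- The `x`-factorial `(n)_x!`. -/
def qnFact (x : K) (n : ℕ) : K := ∏ r ∈ Finset.Icc 1 n, qn x r

/-- The `x`-binomial coefficient `binom_x(n,s)`, zero when `s > n`. -/
def qBinom (x : K) (n s : ℕ) : K :=
  if s ≤ n then qnFact x n / (qnFact x s * qnFact x (n - s)) else 0

/-- The balanced `q`-integer `[n]_q = (q^n - q^{-n})/(q - q^{-1})`. -/
def qint (n : ℕ) : K := (q ^ n - q⁻¹ ^ n) / (q - q⁻¹)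

/-- The balanced `q`-factorial `[n]_q!`. -/
def qintFact (n : ℕ) : K := ∏ r ∈ Finset.Icc 1 n, qint r

variable {A : Type*} [Ring A] [Algebra K A]

/-- The `q`-divided power `X^{(n)} = X^n / [n]_q!`. -/
def dp (X : A) (n : ℕ) : A := (qintFact n)⁻¹ • X ^ n

/-- The `q`-binomial coefficient `C_q(X; c, n) = ∏_{s=1}^n (q^{c+1-s} X - 1)/(q^s - 1)`. -/
def Cq (X : A) (c : ℤ) : ℕ → A
  | 0 => 1
  | n + 1 => (q ^ ((n : ℤ) + 1) - 1)⁻¹ • (Cq X c n * (q ^ (c - (n : ℤ)) • X - 1))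

/-- The bracket `{X; c | n, r} = Σ_{s=0}^r q^{s(s+1)/2} binom_q(r,s) C_q(X; c+s, n-r)`. -/
def Sq (X : A) (c : ℤ) (n r : ℕ) : A :=
  ∑ s ∈ Finset.range (r + 1),
    (q ^ (s * (s + 1) / 2) * qBinom q r s) • Cq X (c + (s : ℤ)) (n - r)

end

lemma q_ne_zero : q ≠ 0 := RatFunc.X_ne_zero

lemma q_pow_sub_one_ne_zero (n : ℕ) : q ^ (n + 1) - 1 ≠ 0 := by
  have h : (Polynomial.X ^ (n + 1) - 1 : Polynomial ℚ) ≠ 0 := by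
    simpa using Polynomial.X_pow_sub_C_ne_zero (Nat.succ_pos n) (1 : ℚ)
  have h' := RatFunc.algebraMap_ne_zero h
  simpa [q, RatFunc.algebraMap_X] using h'

lemma q_sub_one_ne_zero : q - 1 ≠ 0 := by
  simpa using q_pow_sub_one_ne_zero 0

lemma q_sub_inv_ne_zero : q - q⁻¹ ≠ 0 := by
  intro h
  apply q_pow_sub_one_ne_zero 1
  have := q_ne_zero
  field_simp at h
  simpa using h

lemma qn_ne_zero (n : ℕ) : qn q (n + 1) ≠ 0 :=
  div_ne_zero (q_pow_sub_one_ne_zero n) q_sub_one_ne_zero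

lemma qnFact_succ (y : K) (n : ℕ) : qnFact y (n + 1) = qnFact y n * qn y (n + 1) := by
  simp [qnFact, Finset.prod_Icc_succ_top]

lemma qnFact_ne_zero (n : ℕ) : qnFact q n ≠ 0 := by
  induction n with
  | zero => simp [qnFact]
  | succ n ih => rw [qnFact_succ]; exact mul_ne_zero ih (qn_ne_zero n)

lemma qBinom_zero_right (n : ℕ) : qBinom q n 0 = 1 := by
  simp [qBinom, qnFact_ne_zero n, show qnFact q 0 = 1 by simp [qnFact]]

lemma qBinom_self (n : ℕ) : qBinom q n n = 1 := by
  simp [qBinom, qnFact_ne_zero n, show qnFact q 0 = 1 by simp [qnFact]]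

lemma qBinom_of_lt {n s : ℕ} (h : n < s) : qBinom q n s = 0 := by
  simp [qBinom, h]

/-- The Pascal recursion for Gaussian binomial coefficients. -/
lemma qBinom_succ_succ {r s : ℕ} (h : s ≤ r) :
    qBinom q (r + 1) (s + 1) = qBinom q r (s + 1) + q ^ (r - s) * qBinom q r s := by
  obtain ⟨d, rfl⟩ := Nat.exists_eq_add_of_le h
  rcases d with _ | d
  · simp [qBinom_self, qBinom_of_lt]
  · have e1 : s + (d + 1) + 1 - (s + 1) = d + 1 := by omega
    have e2 : s + (d + 1) - (s + 1) = d := by omega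
    have e3 : s + (d + 1) - s = d + 1 := by omega
    rw [qBinom, qBinom, qBinom, if_pos (by omega), if_pos (by omega), if_pos (by omega),
      e1, e2, e3, qnFact_succ q (s + (d + 1)), qnFact_succ q s, qnFact_succ q d]
    have hs := qnFact_ne_zero s
    have hd := qnFact_ne_zero d
    have hs' := qn_ne_zero s
    have hd' := qn_ne_zero d
    have key : qn q (s + (d + 1) + 1) = qn q (d + 1) + q ^ (d + 1) * qn q (s + 1) := by
      have := q_sub_one_ne_zero
      simp only [qn]
      field_simp
      ring
    rw [key]
    field_simp

section Binomials

variable {A : Type*} [Ring A] [Algebra K A]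

attribute [local instance] Semiring.toNatAlgebra Ring.toIntAlgebra -- needed by `module` over `K`

lemma Cq_succ_smul (X : A) (c : ℤ) (n : ℕ) :
    (q ^ (n + 1) - 1) • Cq X c (n + 1) = Cq X c n * (q ^ (c - (n : ℤ)) • X - 1) := by
  rw [Cq, show ((n : ℤ) + 1) = ((n + 1 : ℕ) : ℤ) by push_cast; ring, zpow_natCast,
    smul_inv_smul₀ (q_pow_sub_one_ne_zero n)]

/-- The Pascal recursion for the `q`-binomial coefficients of an algebra element. -/
lemma Cq_add_one_succ (X : A) (c : ℤ) (m : ℕ) :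
    Cq X (c + 1) (m + 1) = q ^ (m + 1) • Cq X c (m + 1) + Cq X c m := by
  induction m with
  | zero =>
    apply smul_right_injective A (q_pow_sub_one_ne_zero 0)
    have h1 := Cq_succ_smul X (c + 1) 0
    have h2 := Cq_succ_smul X c 0
    simp only [Nat.cast_zero, sub_zero, zpow_add_one₀ q_ne_zero, Cq, one_mul] at h1 h2 ⊢
    linear_combination (norm := module) h1 - q • h2
  | succ m ih =>
    apply smul_right_injective A (q_pow_sub_one_ne_zero (m + 1))
    have h1 := Cq_succ_smul X (c + 1) (m + 1)
    have h2 := Cq_succ_smul X c (m + 1)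
    have h3 := Cq_succ_smul X c m
    have e1 : q ^ (c + 1 - ((m + 1 : ℕ) : ℤ)) = q * q ^ (c - ((m + 1 : ℕ) : ℤ)) := by
      rw [← zpow_one_add₀ q_ne_zero]; congr 1; ring
    have e2 : q ^ (c - (m : ℤ)) = q * q ^ (c - ((m + 1 : ℕ) : ℤ)) := by
      rw [← zpow_one_add₀ q_ne_zero]; congr 1; push_cast; ring
    rw [e1, ih] at h1
    rw [e2] at h3
    simp only [add_mul, mul_sub, mul_one, mul_smul_comm, smul_mul_assoc] at h1 h2 h3 ⊢
    linear_combination (norm := module) h1 - q ^ (m + 2) • h2 - h3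

lemma Cq_mul_of_q_commute {x w : A} (hxw : x * w = (q ^ 2 : K) • (w * x)) (c : ℤ) (m : ℕ) :
    Cq x c m * w = w * Cq x (c + 2) m := by
  induction m with
  | zero => simp [Cq]
  | succ m ih =>
    have e : (q ^ (c - (m : ℤ)) • x - 1) * w = w * (q ^ (c + 2 - (m : ℤ)) • x - 1) := by
      rw [show c + 2 - (m : ℤ) = c - m + 2 by ring, zpow_add₀ q_ne_zero, sub_mul, mul_sub,
        smul_mul_assoc, hxw, mul_smul_comm, smul_smul]
      simp only [one_mul, mul_one]
      norm_cast
    rw [Cq, Cq, smul_mul_assoc, mul_assoc, e, ← mul_assoc, ih, mul_smul_comm, mul_assoc]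

/-- The bracket `{X; c | m + r, r}`, indexed by the degree `m` of its `q`-binomial coefficients. -/
noncomputable def bracket (X : A) (r m : ℕ) (c : ℤ) : A :=
  ∑ s ∈ Finset.range (r + 1), (q ^ (s * (s + 1) / 2) * qBinom q r s) • Cq X (c + (s : ℤ)) m

lemma Sq_eq_bracket (X : A) (c : ℤ) (n r : ℕ) : Sq X c n r = bracket X r (n - r) c := rfl

lemma bracket_zero_left (X : A) (m : ℕ) (c : ℤ) : bracket X 0 m c = Cq X c m := by
  simp [bracket, qBinom_self]

lemma bracket_succ (X : A) (r m : ℕ) (c : ℤ) :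
    bracket X (r + 1) m c = bracket X r m c + q ^ (r + 1) • bracket X r m (c + 1) := by
  have h : bracket X r m c = ∑ s ∈ Finset.range (r + 2),
      (q ^ (s * (s + 1) / 2) * qBinom q r s) • Cq X (c + (s : ℤ)) m := by
    rw [Finset.sum_range_succ, qBinom_of_lt (Nat.lt_succ_self r)]
    simp [bracket]
  rw [h, bracket, bracket, Finset.sum_range_succ', Finset.sum_range_succ' _ (r + 1),
    Finset.smul_sum, add_right_comm, ← Finset.sum_add_distrib]
  congr 1
  · refine Finset.sum_congr rfl fun s hs => ?_
    have hs' : s ≤ r := Nat.lt_succ_iff.mp (Finset.mem_range.mp hs)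
    have e : (s + 1) * (s + 1 + 1) / 2 = s * (s + 1) / 2 + (s + 1) := by
      rw [show (s + 1) * (s + 1 + 1) = s * (s + 1) + (s + 1) * 2 by ring,
        Nat.add_mul_div_right _ _ two_pos]
    have e' : q ^ (r + 1) = q ^ (s + 1) * q ^ (r - s) := by
      rw [← pow_add]; congr 1; omega
    rw [qBinom_succ_succ hs', e, e', show c + 1 + (s : ℤ) = c + ((s + 1 : ℕ) : ℤ) by
      push_cast; ring]
    module
  · simp [qBinom_zero_right]

lemma bracket_add_one (X : A) (r m : ℕ) (c : ℤ) :
    bracket X r (m + 1) (c + 1) = q ^ (m + 1) • bracket X r (m + 1) c + bracket X r m c := by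
  simp only [bracket, Finset.smul_sum, ← Finset.sum_add_distrib]
  refine Finset.sum_congr rfl fun s _ => ?_
  rw [add_right_comm, Cq_add_one_succ]
  module

lemma bracket_zero_right (X : A) (r : ℕ) (c d : ℤ) : bracket X r 0 c = bracket X r 0 d := by
  simp [bracket, Cq]

lemma bracket_mul_of_q_commute {x w : A} (hxw : x * w = (q ^ 2 : K) • (w * x))
    (r m : ℕ) (c : ℤ) : bracket x r m c * w = w * bracket x r m (c + 2) := by
  simp only [bracket, Finset.sum_mul, Finset.mul_sum, smul_mul_assoc, mul_smul_comm,
    Cq_mul_of_q_commute hxw, add_right_comm]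

lemma bracket_succ_zero_smul (X : A) (r : ℕ) (c : ℤ) :
    (q ^ (r + 1) - 1) • bracket X (r + 1) 0 c
      = (q ^ (2 * (r + 1)) - 1) • bracket X r 0 (c + 2) := by
  rw [bracket_succ, bracket_zero_right X r c (c + 2), bracket_zero_right X r (c + 1) (c + 2)]
  module

/-- The recursion of the brackets in the degree; the last term vanishes for `r = 0`. -/
lemma bracket_degree_succ (X : A) (r m : ℕ) (c : ℤ) :
    (q ^ (m + r + 1) - 1) • bracket X r (m + 1) c
      = q ^ r • (bracket X r m c * (q ^ (c - m - r) • X - 1))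
        + (q ^ (2 * r) - 1) • bracket X (r - 1) (m + 1) (c + 2) := by
  induction r generalizing c with
  | zero => simpa [bracket_zero_left] using Cq_succ_smul X c m
  | succ r ih =>
    have h0 := ih c
    have h1 := ih (c + 1)
    have hprev : (q ^ (2 * r) - 1) • bracket X (r - 1) (m + 1) (c + 2)
        + (q ^ r * (q ^ (2 * r) - 1)) • bracket X (r - 1) (m + 1) (c + 1 + 2)
        = (q ^ (2 * r) - 1) • bracket X r (m + 1) (c + 2) := by
      rcases r with _ | r
      · simp
      · rw [bracket_succ X r, Nat.add_sub_cancel, add_right_comm c 1 2]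
        module
    have p0 := bracket_add_one X r m c
    have p1 := bracket_add_one X r m (c + 1)
    rw [show c + 1 + 1 = c + 2 by ring] at p1
    have e1 : q ^ (c + 1 - m - r) = q ^ 2 * q ^ (c - m - ((r + 1 : ℕ) : ℤ)) := by
      rw [← zpow_natCast q 2, ← zpow_add₀ q_ne_zero]; congr 1; push_cast; ring
    have e0 : q ^ (c - m - r) = q * q ^ (c - m - ((r + 1 : ℕ) : ℤ)) := by
      rw [← zpow_one_add₀ q_ne_zero]; congr 1; push_cast; ring
    rw [e0] at h0
    rw [e1] at h1
    rw [bracket_succ, bracket_succ, Nat.add_sub_cancel]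
    simp only [add_mul, mul_sub, mul_one, mul_smul_comm, smul_mul_assoc] at h0 h1 ⊢
    linear_combination (norm := module) h0 + q ^ r • h1 + hprev
      + (q ^ r - q ^ (r + 1)) • p0 + (q ^ (2 * r) - q ^ (2 * r + 2)) • p1

lemma qintFact_succ (n : ℕ) : qintFact (n + 1) = qintFact n * qint (n + 1) := by
  simp [qintFact, Finset.prod_Icc_succ_top]

lemma qint_mul (n : ℕ) : (q - q⁻¹) * qint n = q ^ n - (q ^ n)⁻¹ := by
  rw [qint, inv_pow, mul_div_cancel₀ _ q_sub_inv_ne_zero]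

lemma qint_ne_zero (n : ℕ) : qint (n + 1) ≠ 0 := by
  intro h
  have h1 := qint_mul (n + 1)
  have h2 := pow_ne_zero (n + 1) q_ne_zero
  rw [h, mul_zero] at h1
  field_simp at h1
  apply q_pow_sub_one_ne_zero (2 * n + 1)
  linear_combination -h1

lemma dp_mul_self (w : A) (r : ℕ) : dp w r * w = qint (r + 1) • dp w (r + 1) := by
  rw [dp, dp, qintFact_succ, smul_mul_assoc, ← pow_succ, smul_smul, mul_inv, mul_left_comm,
    mul_inv_cancel₀ (qint_ne_zero r), mul_one]

lemma dp_zero (w : A) : dp w 0 = 1 := by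
  simp [dp, qintFact]

/-- Multiplying a summand of the expansion of `C_q` on the right by the next linear factor. -/
lemma smul_dp_mul_Sq_mul {x w : A} (hxw : x * w = (q ^ 2 : K) • (w * x)) (y : K) (n r : ℕ)
    (t : ℤ) :
    ((y ^ r * (q - q⁻¹) ^ r) • (dp w r * Sq x t n r))
        * (y • (x + ((q - q⁻¹) ^ 2 : K) • w) - 1)
      = (y ^ r * (q - q⁻¹) ^ r) • (dp w r * (bracket x r (n - r) t * (y • x - 1)))
        + (y ^ (r + 1) * (q - q⁻¹) ^ (r + 1) * (q ^ (r + 1) - (q ^ (r + 1))⁻¹)) •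
          (dp w (r + 1) * bracket x r (n - r) (t + 2)) := by
  have hw : dp w r * bracket x r (n - r) t * w
      = qint (r + 1) • (dp w (r + 1) * bracket x r (n - r) (t + 2)) := by
    rw [mul_assoc, bracket_mul_of_q_commute hxw, ← mul_assoc, dp_mul_self, smul_mul_assoc]
  rw [← qint_mul, Sq_eq_bracket]
  simp only [mul_sub, mul_add, smul_add, mul_one, mul_smul_comm, smul_mul_assoc, hw,
    ← mul_assoc]
  module

end Binomials

theorem statement2 {A : Type*} [Ring A] [Algebra K A] (x w : A)
    (hxw : x * w = (q ^ 2 : K) • (w * x)) (n : ℕ) (t : ℤ) :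
    Cq (x + ((q - q⁻¹) ^ 2 : K) • w) t n =
      ∑ r ∈ Finset.range (n + 1),
        (q ^ ((r : ℤ) * (t - (n : ℤ))) * (q - q⁻¹) ^ r) • (dp w r * Sq x t n r) := by
  induction n with
  | zero => simp [Cq, Sq_eq_bracket, bracket_zero_left, dp_zero]
  | succ n ih =>
    apply smul_right_injective A (q_pow_sub_one_ne_zero n)
    simp only
    rw [Cq_succ_smul, ih]
    have hq := q_ne_zero
    set y : K := q ^ (t - (n : ℤ)) with hy
    have coeff (r : ℕ) : q ^ ((r : ℤ) * (t - (n : ℤ))) = y ^ r := by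
      rw [mul_comm, zpow_mul, zpow_natCast]
    have coeff' (r : ℕ) : q ^ ((r : ℤ) * (t - ((n + 1 : ℕ) : ℤ))) = (q ^ r)⁻¹ * y ^ r := by
      rw [← coeff, ← zpow_natCast q r, ← zpow_neg, ← zpow_add₀ hq]
      congr 1; push_cast; ring
    simp only [coeff, coeff']
    rw [Finset.sum_mul, Finset.sum_congr rfl fun r _ => smul_dp_mul_Sq_mul hxw y n r t,
      Finset.sum_add_distrib,
      Finset.sum_range_succ', Finset.sum_range_succ _ n,
      Finset.sum_range_succ _ (n + 1), Finset.sum_range_succ' _ n]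
    have first : (q ^ (n + 1) - 1) • (((q ^ 0)⁻¹ * y ^ 0 * (q - q⁻¹) ^ 0) •
          (dp w 0 * Sq x t (n + 1) 0))
        = (y ^ 0 * (q - q⁻¹) ^ 0) • (dp w 0 * (bracket x 0 (n - 0) t * (y • x - 1))) := by
      simpa [Sq_eq_bracket, bracket_zero_left, dp_zero] using Cq_succ_smul x t n
    have last : (q ^ (n + 1) - 1) • (((q ^ (n + 1))⁻¹ * y ^ (n + 1) * (q - q⁻¹) ^ (n + 1)) •
          (dp w (n + 1) * Sq x t (n + 1) (n + 1)))
        = (y ^ (n + 1) * (q - q⁻¹) ^ (n + 1) * (q ^ (n + 1) - (q ^ (n + 1))⁻¹)) •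
          (dp w (n + 1) * bracket x n (n - n) (t + 2)) := by
      have h := congrArg (dp w (n + 1) * ·) (bracket_succ_zero_smul x n t)
      simp only [mul_smul_comm] at h
      rw [Sq_eq_bracket, Nat.sub_self, Nat.sub_self, smul_comm, h, smul_smul]
      congr 1
      field_simp
      ring
    have middle (r : ℕ) (hr : r ∈ Finset.range n) :
        (q ^ (n + 1) - 1) • (((q ^ (r + 1))⁻¹ * y ^ (r + 1) * (q - q⁻¹) ^ (r + 1)) •
          (dp w (r + 1) * Sq x t (n + 1) (r + 1)))
        = (y ^ (r + 1) * (q - q⁻¹) ^ (r + 1)) •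
            (dp w (r + 1) * (bracket x (r + 1) (n - (r + 1)) t * (y • x - 1)))
          + (y ^ (r + 1) * (q - q⁻¹) ^ (r + 1) * (q ^ (r + 1) - (q ^ (r + 1))⁻¹)) •
            (dp w (r + 1) * bracket x r (n - r) (t + 2)) := by
      obtain ⟨m, rfl⟩ := Nat.exists_eq_add_of_le (Nat.succ_le_of_lt (Finset.mem_range.mp hr))
      have h := congrArg (dp w (r + 1) * ·) (bracket_degree_succ x (r + 1) m t)
      have ey : q ^ (t - m - ((r + 1 : ℕ) : ℤ)) = y := by
        rw [hy]; congr 1; push_cast; ring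
      rw [ey, Nat.add_sub_cancel, show m + (r + 1) + 1 = r.succ + m + 1 by omega] at h
      simp only [mul_add, mul_smul_comm] at h
      rw [Sq_eq_bracket, show r.succ + m + 1 - (r + 1) = m + 1 by omega,
        show r.succ + m - (r + 1) = m by omega, show r.succ + m - r = m + 1 by omega,
        smul_comm, h, smul_add, smul_smul, smul_smul]
      congr 2
      · field_simp
      · field_simp
        ring
    rw [smul_add, smul_add, first, last, Finset.smul_sum, Finset.sum_congr rfl middle,
      Finset.sum_add_distrib]
    abel
end

section
/- Let Ω be a unital associative algebra over the Laurent polynomial ring ℤ[q,q^{−1}], let ℓ be a positive integer and φ_ℓ(q) the ℓ-th cyclotomic polynomial. Suppose x ∈ Ω is such that there exists z ∈ Ω with (∏_{s=1}^{ℓ} (q^s − 1)) · z = ∏_{s=1}^{ℓ} (q^{1−s}x − 1) in Ω (i.e. the q-binomial coefficient C_q(x;0,ℓ) 'lies in Ω'). Then x^ℓ − 1 ∈ φ_ℓ(q)·Ω; equivalently, the image of x in Ω_ε := Ω/φ_ℓ(q)Ω (the specialization of Ω at a primitive ℓ-th root of unity ε) satisfies x^ℓ = 1. -/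
open Finset LaurentPolynomial

noncomputable section

variable {Ω : Type*} [Ring Ω] [Algebra (LaurentPolynomial ℤ) Ω]

/-- The product `∏_{s=1}^{n} (q^{1-s} x - 1)` in `Ω`. -/
def parenPowL (x : Ω) : ℕ → Ω
  | 0 => 1
  | n + 1 => parenPowL x n * ((T (-(n : ℤ)) : LaurentPolynomial ℤ) • x - 1)

theorem parenPowL_eq_aeval (x : Ω) (n : ℕ) :
    parenPowL x n = Polynomial.aeval x (∏ s ∈ range n,
      (Polynomial.C (T (-(s : ℤ)) : LaurentPolynomial ℤ) * Polynomial.X - 1)) := by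
  induction n with
  | zero => simp [parenPowL]
  | succ n ih => simp [parenPowL, ih, prod_range_succ, Algebra.smul_def]

/-- A Laurent polynomial vanishing at a primitive `ℓ`-th root of unity is a multiple of the
`ℓ`-th cyclotomic polynomial. -/
theorem toLaurent_cyclotomic_dvd_of_eval₂_eq_zero {ℓ : ℕ} (hℓ : 0 < ℓ) {u : ℂˣ}
    (hu : IsPrimitiveRoot (u : ℂ) ℓ) {p : LaurentPolynomial ℤ}
    (hp : eval₂ (Int.castRingHom ℂ) u p = 0) :
    Polynomial.toLaurent (Polynomial.cyclotomic ℓ ℤ) ∣ p := by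
  obtain ⟨n, f, hf⟩ := exists_T_pow p
  have hf0 : Polynomial.aeval (u : ℂ) f = 0 := by
    have h := congrArg (eval₂ (Int.castRingHom ℂ) u) hf
    rw [eval₂_toLaurent, map_mul, hp, zero_mul] at h
    rw [Polynomial.aeval_def]
    exact h
  have hdvd : Polynomial.cyclotomic ℓ ℤ ∣ f := by
    rw [Polynomial.cyclotomic_eq_minpoly hu hℓ]
    exact minpoly.isIntegrallyClosed_dvd (hu.isIntegral hℓ) hf0
  have h := map_dvd Polynomial.toLaurent hdvd
  rw [hf] at h
  exact (isUnit_T (n : ℤ)).dvd_mul_right.mp h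

/-- Modulo the `ℓ`-th cyclotomic polynomial, `∏_{s<ℓ} (X - q^s)` agrees with `X^ℓ - 1`. -/
theorem C_cyclotomic_dvd_X_pow_sub_one_sub_prod {ℓ : ℕ} (hℓ : 0 < ℓ) :
    Polynomial.C (Polynomial.toLaurent (Polynomial.cyclotomic ℓ ℤ)) ∣
      (Polynomial.X ^ ℓ - 1 - ∏ s ∈ range ℓ,
        (Polynomial.X - Polynomial.C (T (s : ℤ) : LaurentPolynomial ℤ))) := by
  have hζ := Complex.isPrimitiveRoot_exp ℓ hℓ.ne'
  obtain ⟨u, hu⟩ := hζ.isUnit hℓ.ne'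
  rw [← hu] at hζ
  rw [Polynomial.C_dvd_iff_dvd_coeff]
  intro i
  apply toLaurent_cyclotomic_dvd_of_eval₂_eq_zero hℓ hζ
  rw [← Polynomial.coeff_map]
  have h := X_pow_sub_C_eq_prod hζ hℓ (one_pow ℓ)
  simp only [map_one, mul_one] at h
  simp [Polynomial.map_prod, Polynomial.map_sub, h]

theorem prod_X_sub_C_T (ℓ : ℕ) :
    ∏ s ∈ range ℓ, ((Polynomial.X : Polynomial (LaurentPolynomial ℤ)) - Polynomial.C (T (s : ℤ))) =
      Polynomial.C (∏ s ∈ range ℓ, (T (s : ℤ) : LaurentPolynomial ℤ)) * ∏ s ∈ range ℓ,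
        (Polynomial.C (T (-(s : ℤ)) : LaurentPolynomial ℤ) * Polynomial.X - 1) := by
  rw [map_prod, ← prod_mul_distrib]
  refine prod_congr rfl fun s _ => ?_
  rw [mul_sub, ← mul_assoc, ← Polynomial.C_mul, ← T_add]
  simp

theorem toLaurent_cyclotomic_dvd_prod {ℓ : ℕ} (hℓ : 0 < ℓ) :
    Polynomial.toLaurent (Polynomial.cyclotomic ℓ ℤ) ∣
      ∏ s ∈ Finset.Icc 1 ℓ, ((T (s : ℤ) : LaurentPolynomial ℤ) - 1) := by
  refine Dvd.dvd.trans ?_ (dvd_prod_of_mem _ (mem_Icc.mpr ⟨hℓ, le_rfl⟩))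
  simpa using map_dvd Polynomial.toLaurent (Polynomial.cyclotomic.dvd_X_pow_sub_one ℓ ℤ)

theorem statement5 (ℓ : ℕ) (hℓ : 0 < ℓ) (x : Ω)
    (hx : ∃ z : Ω, (∏ s ∈ Finset.Icc 1 ℓ, ((T (s : ℤ) : LaurentPolynomial ℤ) - 1)) • z = parenPowL x ℓ) :
    ∃ w : Ω, x ^ ℓ - 1 = (Polynomial.toLaurent (Polynomial.cyclotomic ℓ ℤ)) • w := by
  obtain ⟨z, hz⟩ := hx
  obtain ⟨Q, hQ⟩ := C_cyclotomic_dvd_X_pow_sub_one_sub_prod hℓ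
  obtain ⟨d, hd⟩ := toLaurent_cyclotomic_dvd_prod hℓ
  have h := congrArg (Polynomial.aeval x) hQ
  rw [prod_X_sub_C_T, map_sub, map_mul, ← parenPowL_eq_aeval, ← hz, hd, map_mul,
    Polynomial.aeval_C, Polynomial.aeval_C, ← Algebra.smul_def, ← Algebra.smul_def,
    sub_eq_iff_eq_add] at h
  refine ⟨Polynomial.aeval x Q + (∏ s ∈ range ℓ, (T (s : ℤ) : LaurentPolynomial ℤ)) • d • z, ?_⟩
  rw [smul_add, smul_comm _ (∏ s ∈ range ℓ, _), smul_smul _ d z, ← h]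
  simp

end
end
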